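/- Consider the implicit L2-1_σ difference scheme for the 1D time fractional reaction-diffusion equation with homogeneous boundary conditions, and let K > 0. There exists a constant C₂ > 0, depending only on α, T, σ and K (but not on N, M, h, τ), with the following property: if the grid function e = (e_i^j), 0 ≤ i ≤ N, 0 ≤ j ≤ M, satisfies e_i^0 = 0 for all i, e_0^j = e_N^j = 0 for all j, the convention e_i^{-1} = e_i^0, and the error equation δ_t̂ e_i^j + Δ^α e_i^j = σ(Λ^j e^{j+1})_i + (1-σ)(Λ^j e^j)_i + R_i^{j+σ} for all 1 ≤ i ≤ N-1, 0 ≤ j ≤ M-1, where the residuals satisfy ‖R^{j+σ}‖ ≤ K (τ² + h²) for all 0 ≤ j ≤ M-1, then ‖e^j‖ ≤ C₂ (τ² + h²) for all 0 ≤ j ≤ M. In particular the scheme converges with optimal order O(τ² + h²) in the discrete L₂ norm. -/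

import Mathlib

/-- `a_l^{(α,σ)}`: `a_0 = σ^{1-α}`, `a_l = (l+σ)^{1-α} - (l-1+σ)^{1-α}` for `l ≥ 1`. -/
noncomputable def aC (α σ : ℝ) (l : ℕ) : ℝ :=
  if l = 0 then σ ^ (1 - α)
  else ((l : ℝ) + σ) ^ (1 - α) - ((l : ℝ) - 1 + σ) ^ (1 - α)

/-- `b_l^{(α,σ)}` for `l ≥ 1`. -/
noncomputable def bC (α σ : ℝ) (l : ℕ) : ℝ :=
  (((l : ℝ) + σ) ^ (2 - α) - ((l : ℝ) - 1 + σ) ^ (2 - α)) / (2 - α)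
    - (((l : ℝ) + σ) ^ (1 - α) - ((l : ℝ) - 1 + σ) ^ (1 - α)) / 2

/-- `c_s^{(α,σ)}` with top index `j`. -/
noncomputable def cC (α σ : ℝ) (j s : ℕ) : ℝ :=
  if j = 0 then aC α σ 0
  else if s = 0 then aC α σ 0 + bC α σ 1
  else if s = j then aC α σ j - bC α σ j
  else aC α σ s + bC α σ (s + 1) - bC α σ s

/-- Drift approximation `δ_t̂ v^j = (1/(2τ))[(2σ+1)v^{j+1} - 4σ v^j + (2σ-1)v^{j-1}]`
(natural subtraction realizes the convention `v^{-1} = v^0`). -/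
noncomputable def driftD (σ τ : ℝ) (v : ℕ → ℝ) (j : ℕ) : ℝ :=
  (1 / (2 * τ)) * ((2 * σ + 1) * v (j + 1) - 4 * σ * v j + (2 * σ - 1) * v (j - 1))

/-- Discrete Caputo (L2-1_σ) operator
`Δ^α v^j = (τ^{-α}/Γ(2-α)) Σ_{s=0}^{j} c_{j-s}^{(α,σ)}(v^{s+1} - v^s)`. -/
noncomputable def fracD (α σ τ : ℝ) (v : ℕ → ℝ) (j : ℕ) : ℝ :=
  (τ ^ (-α) / Real.Gamma (2 - α)) *
    ∑ s ∈ Finset.range (j + 1), cC α σ j (j - s) * (v (s + 1) - v s)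

/-- 1D discrete variable-coefficient diffusion-reaction operator
`(Λ v)_i = h^{-2}[k(x_i+h/2,t)(v_{i+1}-v_i) - k(x_i-h/2,t)(v_i-v_{i-1})] - q(x_i,t)v_i`. -/
noncomputable def lam1D (k q : ℝ → ℝ → ℝ) (h t : ℝ) (v : ℕ → ℝ) (i : ℕ) : ℝ :=
  (1 / h ^ 2) * (k ((i : ℝ) * h + h / 2) t * (v (i + 1) - v i)
      - k ((i : ℝ) * h - h / 2) t * (v i - v (i - 1)))
    - q ((i : ℝ) * h) t * v i

/-- Discrete squared `L₂` norm `‖v‖² = h Σ_{i=1}^{N-1} v_i²`. -/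
noncomputable def nrm2 (h : ℝ) (N : ℕ) (v : ℕ → ℝ) : ℝ :=
  h * ∑ i ∈ Finset.Icc 1 (N - 1), (v i) ^ 2

section Kernel

open Set

/-- If `G' = u` and `u` is monotone on the positive axis, then the increment of `G` over a unit
step is at most the final slope. -/
theorem unit_step_le_of_monotoneOn {G u : ℝ → ℝ} (hG : ∀ x > 0, HasDerivAt G (u x) x)
    (hu : MonotoneOn u (Ioi 0)) {x y : ℝ} (hx : 0 < x) (hxy : x < y) :
    G y - G x ≤ u y * (y - x) := by
  obtain ⟨c, hc, h⟩ := exists_hasDerivAt_eq_slope G u hxy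
    (fun z hz => (hG z (hx.trans_le hz.1)).continuousAt.continuousWithinAt)
    (fun z hz => hG z (hx.trans hz.1))
  rw [eq_div_iff (sub_pos.2 hxy).ne'] at h
  rw [← h]
  exact mul_le_mul_of_nonneg_right
    (hu (hx.trans hc.1) (hx.trans hxy) hc.2.le) (sub_pos.2 hxy).le

/-- The trapezoidal rule underestimates the integral of a concave function. -/
theorem trapezoid_le {G u u' : ℝ → ℝ} (hG : ∀ x > 0, HasDerivAt G (u x) x)
    (hu : ∀ x > 0, HasDerivAt u (u' x) x) (hu' : AntitoneOn u' (Ioi 0)) {x : ℝ} (hx : 0 < x) :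
    (u x + u (x + 1)) / 2 ≤ G (x + 1) - G x := by
  have hd : ∀ y > 0, HasDerivAt (fun y => G y - (y - x) / 2 * (u x + u y))
      (u y - (1 / 2 * (u x + u y) + (y - x) / 2 * u' y)) y := fun y hy =>
    (hG y hy).sub (((((hasDerivAt_id y).sub_const x).div_const 2).mul
      ((hu y hy).const_add (u x))))
  have hmono : MonotoneOn (fun y => G y - (y - x) / 2 * (u x + u y)) (Ici x) := by
    refine monotoneOn_of_deriv_nonneg (convex_Ici x)
      (fun y hy => (hd y (hx.trans_le hy)).continuousAt.continuousWithinAt)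
      (fun y hy => ?_) (fun y hy => ?_)
    · rw [interior_Ici] at hy
      exact (hd y (hx.trans hy)).differentiableAt.differentiableWithinAt
    · rw [interior_Ici] at hy
      rw [(hd y (hx.trans hy)).deriv]
      have := unit_step_le_of_monotoneOn (G := fun z => -u z) (u := fun z => -u' z)
        (fun z hz => (hu z hz).neg) hu'.neg hx hy
      linarith
  have := hmono (mem_Ici.2 le_rfl) (mem_Ici.2 (by linarith : x ≤ x + 1)) (by linarith)
  simp only at this
  linarith

variable {α : ℝ}

theorem hasDerivAt_rpow_primitive (hα : α < 1) (x : ℝ) (hx : 0 < x) :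
    HasDerivAt (fun x : ℝ => x ^ (2 - α) / (2 - α)) (x ^ (1 - α)) x := by
  have h := (Real.hasDerivAt_rpow_const (p := 2 - α) (Or.inl hx.ne')).div_const (2 - α)
  have h2 : 2 - α ≠ 0 := by linarith
  rwa [show 2 - α - 1 = 1 - α by ring, mul_div_cancel_left₀ _ h2] at h

theorem hasDerivAt_rpow_one_sub (x : ℝ) (hx : 0 < x) :
    HasDerivAt (fun x : ℝ => x ^ (1 - α)) ((1 - α) * x ^ (-α)) x := by
  have h := Real.hasDerivAt_rpow_const (p := 1 - α) (Or.inl hx.ne')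
  rwa [show 1 - α - 1 = -α by ring] at h

theorem hasDerivAt_rpow_neg (x : ℝ) (hx : 0 < x) :
    HasDerivAt (fun x : ℝ => (1 - α) * x ^ (-α)) (-(α * (1 - α) * x ^ (-α - 1))) x := by
  have h := (Real.hasDerivAt_rpow_const (p := -α) (Or.inl hx.ne')).const_mul (1 - α)
  rwa [show (1 - α) * (-α * x ^ (-α - 1)) = -(α * (1 - α) * x ^ (-α - 1)) by ring] at h

theorem antitoneOn_rpow_neg (hα : 0 < α ∧ α < 1) :
    AntitoneOn (fun x : ℝ => (1 - α) * x ^ (-α)) (Ioi 0) := fun _ hx _ _ hxy =>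
  mul_le_mul_of_nonneg_left (Real.rpow_le_rpow_of_nonpos hx hxy (by linarith)) (by linarith)

theorem monotoneOn_rpow_one_sub (hα : α < 1) :
    MonotoneOn (fun x : ℝ => x ^ (1 - α)) (Ioi 0) := fun _ hx _ _ hxy =>
  Real.rpow_le_rpow (le_of_lt hx) hxy (by linarith)

/-- `x ^ (1 - α)` lies above its trapezoidal chord in mean. -/
theorem trapezoid_rpow_one_sub_le (hα : 0 < α ∧ α < 1) {x : ℝ} (hx : 0 < x) :
    (x ^ (1 - α) + (x + 1) ^ (1 - α)) / 2
      ≤ (x + 1) ^ (2 - α) / (2 - α) - x ^ (2 - α) / (2 - α) :=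
  trapezoid_le (hasDerivAt_rpow_primitive hα.2) hasDerivAt_rpow_one_sub
    (antitoneOn_rpow_neg hα) hx

/-- `x ^ (-α)` lies below its trapezoidal chord in mean. -/
theorem le_trapezoid_rpow_neg (hα : 0 < α ∧ α < 1) {x : ℝ} (hx : 0 < x) :
    (x + 1) ^ (1 - α) - x ^ (1 - α)
      ≤ ((1 - α) * x ^ (-α) + (1 - α) * (x + 1) ^ (-α)) / 2 := by
  have h := trapezoid_le (G := fun x : ℝ => -x ^ (1 - α))
    (u := fun x : ℝ => -((1 - α) * x ^ (-α))) (u' := fun x : ℝ => - -(α * (1 - α) * x ^ (-α - 1)))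
    (fun y hy => (hasDerivAt_rpow_one_sub y hy).neg) (fun y hy => (hasDerivAt_rpow_neg y hy).neg)
    (fun a ha b _ hab => by
      have h1 := Real.rpow_le_rpow_of_nonpos ha hab (by linarith : -α - 1 ≤ 0)
      have h2 : 0 ≤ α * (1 - α) := mul_nonneg hα.1.le (by linarith)
      simpa using mul_le_mul_of_nonneg_left h1 h2) hx
  linarith

theorem rpow_neg_le_unit_step (hα : 0 < α ∧ α < 1) {x : ℝ} (hx : 0 < x) :
    (1 - α) * (x + 1) ^ (-α) ≤ (x + 1) ^ (1 - α) - x ^ (1 - α) := by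
  have h := unit_step_le_of_monotoneOn (G := fun x : ℝ => -x ^ (1 - α))
    (u := fun x : ℝ => -((1 - α) * x ^ (-α)))
    (fun y hy => (hasDerivAt_rpow_one_sub y hy).neg) (antitoneOn_rpow_neg hα).neg hx
    (by linarith : x < x + 1)
  linarith

theorem rpow_primitive_unit_step_le (hα : α < 1) {x : ℝ} (hx : 0 < x) :
    (x + 1) ^ (2 - α) / (2 - α) - x ^ (2 - α) / (2 - α) ≤ (x + 1) ^ (1 - α) := by
  have h := unit_step_le_of_monotoneOn (hasDerivAt_rpow_primitive hα)
    (monotoneOn_rpow_one_sub hα) hx (by linarith : x < x + 1)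
  linarith

/-- The error of the trapezoidal rule for `x ^ (1 - α)` on `[x, x + 1]`. -/
noncomputable def trapError (α x : ℝ) : ℝ :=
  (x + 1) ^ (2 - α) / (2 - α) - x ^ (2 - α) / (2 - α) - (x ^ (1 - α) + (x + 1) ^ (1 - α)) / 2

theorem hasDerivAt_trapError (hα : α < 1) {x : ℝ} (hx : 0 < x) :
    HasDerivAt (trapError α) ((x + 1) ^ (1 - α) - x ^ (1 - α)
      - ((1 - α) * x ^ (-α) + (1 - α) * (x + 1) ^ (-α)) / 2) x :=
  (((hasDerivAt_rpow_primitive hα (x + 1) (by linarith)).comp_add_const x 1).sub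
    (hasDerivAt_rpow_primitive hα x hx)).sub
    (((hasDerivAt_rpow_one_sub x hx).add
      ((hasDerivAt_rpow_one_sub (x + 1) (by linarith)).comp_add_const x 1)).div_const 2)

theorem trapError_nonneg (hα : 0 < α ∧ α < 1) {x : ℝ} (hx : 0 < x) : 0 ≤ trapError α x := by
  have := trapezoid_rpow_one_sub_le hα hx
  unfold trapError
  linarith

theorem antitoneOn_trapError (hα : 0 < α ∧ α < 1) : AntitoneOn (trapError α) (Ioi 0) := by
  refine antitoneOn_of_deriv_nonpos (convex_Ioi 0)
    (fun y hy => (hasDerivAt_trapError hα.2 hy).continuousAt.continuousWithinAt)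
    (fun y hy => ?_) (fun y hy => ?_)
  · rw [interior_Ioi] at hy
    exact (hasDerivAt_trapError hα.2 hy).differentiableAt.differentiableWithinAt
  · rw [interior_Ioi] at hy
    rw [(hasDerivAt_trapError hα.2 hy).deriv]
    have := le_trapezoid_rpow_neg hα hy
    linarith

/-- The memory kernel of the scheme at lag `x + 1 - σ`. -/
noncomputable def memoryKernel (α x : ℝ) : ℝ :=
  2 * ((x + 1) ^ (1 - α) - x ^ (1 - α)) + (trapError α (x + 1) - trapError α x)

theorem memoryKernel_nonneg (hα : 0 < α ∧ α < 1) {x : ℝ} (hx : 0 < x) :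
    0 ≤ memoryKernel α x := by
  have h1 := trapezoid_rpow_one_sub_le hα (by linarith : 0 < x + 1)
  have h2 := rpow_primitive_unit_step_le hα.2 hx
  have h3 : x ^ (1 - α) ≤ (x + 1) ^ (1 - α) :=
    monotoneOn_rpow_one_sub hα.2 hx (mem_Ioi.2 (by linarith)) (by linarith)
  unfold memoryKernel trapError
  linarith

theorem memoryKernel_le (hα : 0 < α ∧ α < 1) {x : ℝ} (hx : 0 < x) :
    memoryKernel α x ≤ 2 * ((x + 1) ^ (1 - α) - x ^ (1 - α)) := by
  have := antitoneOn_trapError hα hx (mem_Ioi.2 (by linarith : 0 < x + 1)) (by linarith)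
  unfold memoryKernel
  linarith

theorem antitoneOn_memoryKernel (hα : 0 < α ∧ α < 1) :
    AntitoneOn (memoryKernel α) (Ioi 0) := by
  have hd : ∀ x > 0, HasDerivAt (memoryKernel α) _ x := fun x hx =>
    ((((hasDerivAt_rpow_one_sub (α := α) (x + 1) (by linarith)).comp_add_const x 1).sub
      (hasDerivAt_rpow_one_sub x hx)).const_mul 2).add
    (((hasDerivAt_trapError hα.2 (by linarith : 0 < x + 1)).comp_add_const x 1).sub
      (hasDerivAt_trapError hα.2 hx))
  refine antitoneOn_of_deriv_nonpos (convex_Ioi 0)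
    (fun y hy => (hd y hy).continuousAt.continuousWithinAt)
    (fun y hy => ?_) (fun y hy => ?_)
  · rw [interior_Ioi] at hy
    exact (hd y hy).differentiableAt.differentiableWithinAt
  · rw [interior_Ioi] at hy
    rw [(hd y hy).deriv]
    have hy' : 0 < y := hy
    have h1 := le_trapezoid_rpow_neg hα (by linarith : 0 < y + 1)
    have h2 := rpow_neg_le_unit_step hα hy'
    have h3 := antitoneOn_rpow_neg hα hy (mem_Ioi.2 (by linarith : 0 < y + 1)) (by linarith)
    simp only at h3
    linarith

end Kernel

/-- The Toeplitz part of the coefficients `cC`. -/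
noncomputable def toeplitzC (α σ : ℝ) (s : ℕ) : ℝ :=
  aC α σ s + bC α σ (s + 1) - if s = 0 then 0 else bC α σ s

theorem cC_eq_toeplitzC (α σ : ℝ) {j s : ℕ} (hsj : s ≤ j) :
    cC α σ j s = toeplitzC α σ s - if s = j then bC α σ (j + 1) else 0 := by
  unfold cC toeplitzC
  by_cases hj : j = 0
  · subst hj
    obtain rfl : s = 0 := Nat.le_zero.1 hsj
    simp
  · by_cases hs : s = 0
    · simp [hs, hj, Ne.symm hj]
    · by_cases hsj' : s = j
      · subst hsj'
        simp only [hs, if_false, if_true]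
        ring
      · simp [hs, hj, hsj']

theorem bC_succ_eq (α σ : ℝ) (l : ℕ) :
    bC α σ (l + 1) = trapError α (l + σ) + ((l : ℝ) + σ) ^ (1 - α) := by
  unfold bC trapError
  push_cast
  rw [show (l : ℝ) + 1 + σ = l + σ + 1 by ring, show (l : ℝ) + 1 - 1 + σ = l + σ by ring]
  ring

theorem toeplitzC_zero (α σ : ℝ) : toeplitzC α σ 0 = 2 * σ ^ (1 - α) + trapError α σ := by
  simp only [toeplitzC, aC, bC_succ_eq]
  simp
  ring

theorem toeplitzC_succ (α σ : ℝ) (s : ℕ) :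
    toeplitzC α σ (s + 1) = memoryKernel α (s + σ) := by
  have h1 := bC_succ_eq α σ (s + 1)
  rw [toeplitzC, h1, bC_succ_eq]
  simp only [aC, memoryKernel]
  push_cast
  rw [show (s : ℝ) + 1 + σ = s + σ + 1 by ring, show (s : ℝ) + 1 - 1 + σ = s + σ by ring]
  ring

section Coefficients

variable {α σ : ℝ}

theorem toeplitzC_nonneg (hα : 0 < α ∧ α < 1) (hσ : 0 < σ) (s : ℕ) : 0 ≤ toeplitzC α σ s := by
  cases s with
  | zero =>
    rw [toeplitzC_zero]
    have := trapError_nonneg hα hσ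
    have := Real.rpow_nonneg hσ.le (1 - α)
    linarith
  | succ s =>
    rw [toeplitzC_succ]
    exact memoryKernel_nonneg hα (by positivity)

theorem toeplitzC_succ_succ_le (hα : 0 < α ∧ α < 1) (hσ : 0 < σ) (s : ℕ) :
    toeplitzC α σ (s + 2) ≤ toeplitzC α σ (s + 1) := by
  rw [toeplitzC_succ, toeplitzC_succ]
  have h : 0 < (s : ℝ) + σ := by positivity
  refine antitoneOn_memoryKernel hα h (Set.mem_Ioi.2 ?_) ?_ <;> push_cast <;> linarith

theorem sq_mul_toeplitzC_one_le (hα : 0 < α ∧ α < 1) (hσ : σ = 1 - α / 2) :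
    σ ^ 2 * toeplitzC α σ 1 ≤ (2 * σ - 1) * toeplitzC α σ 0 := by
  have hσ0 : 0 < σ := by linarith
  have hσ1 : σ ≤ 1 := by linarith
  have h1 := memoryKernel_le hα hσ0
  have h2 := trapError_nonneg hα hσ0
  have h3 : (σ + 1) ^ (1 - α) ≤ σ ^ (1 - α) * (1 + (1 - α) * (1 / σ)) := by
    rw [show σ + 1 = σ * (1 + 1 / σ) by field_simp, Real.mul_rpow hσ0.le (by positivity)]
    refine mul_le_mul_of_nonneg_left (rpow_one_add_le_one_add_mul_self ?_ ?_ ?_)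
      (Real.rpow_nonneg hσ0.le _)
    · have : 0 < 1 / σ := by positivity
      linarith
    · linarith
    · linarith
  have hp := Real.rpow_nonneg hσ0.le (1 - α)
  have h4 := toeplitzC_succ α σ 0
  simp only [Nat.cast_zero, zero_add] at h4
  rw [h4, toeplitzC_zero]
  calc σ ^ 2 * memoryKernel α σ
      ≤ σ ^ 2 * (2 * (σ ^ (1 - α) * (1 + (1 - α) * (1 / σ)) - σ ^ (1 - α))) := by
        gcongr
        linarith
    _ = σ * ((1 - α) * (2 * σ ^ (1 - α))) := by
        field_simp
        ring
    _ ≤ 1 * ((1 - α) * (2 * σ ^ (1 - α))) := by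
        gcongr
        exact mul_nonneg (by linarith) (by linarith)
    _ ≤ (2 * σ - 1) * (2 * σ ^ (1 - α) + trapError α σ) := by
        rw [one_mul, show 2 * σ - 1 = 1 - α by linarith]
        refine mul_le_mul_of_nonneg_left (by linarith) (by linarith)

theorem bC_succ_nonneg (hα : 0 < α ∧ α < 1) (hσ : 0 < σ) (l : ℕ) : 0 ≤ bC α σ (l + 1) := by
  rw [bC_succ_eq]
  have h : 0 < (l : ℝ) + σ := by positivity
  exact add_nonneg (trapError_nonneg hα h) (Real.rpow_nonneg h.le _)

theorem bC_succ_le (hα : 0 < α ∧ α < 1) (hσ : 0 < σ) (l : ℕ) :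
    bC α σ (l + 1) ≤ ((l : ℝ) + σ + 1) ^ (1 - α) := by
  rw [bC_succ_eq]
  have h : 0 < (l : ℝ) + σ := by positivity
  have h2 := rpow_primitive_unit_step_le hα.2 h
  have h3 : ((l : ℝ) + σ) ^ (1 - α) ≤ ((l : ℝ) + σ + 1) ^ (1 - α) :=
    monotoneOn_rpow_one_sub hα.2 h (Set.mem_Ioi.2 (by linarith)) (by linarith)
  unfold trapError
  linarith

end Coefficients

section DiscreteEnergy

/-- Alikhanov's inequality for a discrete convolution with a nonincreasing kernel. -/
theorem convolution_sq_le {g : ℕ → ℝ} {σ : ℝ} (hg : ∀ s, 0 ≤ g s)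
    (hanti : ∀ s, g (s + 2) ≤ g (s + 1)) (h01 : σ ^ 2 * g 1 ≤ (2 * σ - 1) * g 0)
    (v : ℕ → ℝ) (j : ℕ) :
    ∑ s ∈ Finset.range (j + 1), g (j - s) * (v (s + 1) ^ 2 - v s ^ 2)
      ≤ 2 * (σ * v (j + 1) + (1 - σ) * v j) *
        ∑ s ∈ Finset.range (j + 1), g (j - s) * (v (s + 1) - v s) := by
  set w := σ * v (j + 1) + (1 - σ) * v j with hw
  have habel : ∀ n ≤ j, -(g (j - n + 1) * (w - v n) ^ 2)
      ≤ ∑ s ∈ Finset.range n, g (j - s) * ((w - v s) ^ 2 - (w - v (s + 1)) ^ 2) := by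
    intro n
    induction n with
    | zero =>
      intro _
      simpa using mul_nonneg (hg _) (sq_nonneg _)
    | succ n ih =>
      intro hn
      have h1 := ih (by lia)
      obtain ⟨m, rfl⟩ : ∃ m, j = n + 1 + m := ⟨j - (n + 1), by lia⟩
      rw [Finset.sum_range_succ]
      rw [show n + 1 + m - n = m + 1 by lia] at h1 ⊢
      rw [show n + 1 + m - (n + 1) = m by lia]
      have h2 := mul_le_mul_of_nonneg_right (hanti m) (sq_nonneg (w - v n))
      linarith
  have h1 := habel j le_rfl
  have h2 : (0 : ℝ) ≤ ((2 * σ - 1) * g 0 - σ ^ 2 * g 1) * (v (j + 1) - v j) ^ 2 :=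
    mul_nonneg (by linarith) (sq_nonneg _)
  have h3 : 2 * w * ∑ s ∈ Finset.range (j + 1), g (j - s) * (v (s + 1) - v s)
      - ∑ s ∈ Finset.range (j + 1), g (j - s) * (v (s + 1) ^ 2 - v s ^ 2)
      = ∑ s ∈ Finset.range (j + 1), g (j - s) * ((w - v s) ^ 2 - (w - v (s + 1)) ^ 2) := by
    rw [Finset.mul_sum, ← Finset.sum_sub_distrib]
    exact Finset.sum_congr rfl fun s _ => by ring
  rw [Finset.sum_range_succ (fun s => g (j - s) * ((w - v s) ^ 2 - (w - v (s + 1)) ^ 2))] at h3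
  simp only [Nat.sub_self, zero_add] at h1 h3
  have h4 : g 0 * ((w - v j) ^ 2 - (w - v (j + 1)) ^ 2) - g 1 * (w - v j) ^ 2
      = ((2 * σ - 1) * g 0 - σ ^ 2 * g 1) * (v (j + 1) - v j) ^ 2 := by
    rw [hw]
    ring
  linarith

theorem sum_convolution_eq (g : ℕ → ℝ) {V : ℕ → ℝ} (h0 : V 0 = 0) (n : ℕ) :
    ∑ j ∈ Finset.range n, ∑ s ∈ Finset.range (j + 1), g (j - s) * (V (s + 1) - V s)
      = ∑ s ∈ Finset.range n, g (n - 1 - s) * V (s + 1) := by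
  induction n with
  | zero => simp
  | succ n ih =>
    rw [Finset.sum_range_succ, ih]
    simp only [mul_sub, Finset.sum_sub_distrib]
    rw [Finset.sum_range_succ' (fun s => g (n - s) * V s), h0, Nat.add_sub_cancel]
    have : ∀ s, n - 1 - s = n - (s + 1) := fun s => by lia
    simp only [this]
    ring

/-- The discrete energy controlled by `driftD`. -/
noncomputable def driftEnergy (σ : ℝ) (v : ℕ → ℝ) (j : ℕ) : ℝ :=
  (2 * σ + 1) * v j ^ 2 - (2 * σ - 1) * v (j - 1) ^ 2
    + (2 * σ - 1) * (σ + 1) * (v j - v (j - 1)) ^ 2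

theorem sq_le_driftEnergy {σ : ℝ} (h1 : 1 / 2 ≤ σ) (h2 : σ ≤ 1) (v : ℕ → ℝ) (j : ℕ) :
    v j ^ 2 ≤ driftEnergy σ v j := by
  have hσ : 0 < σ := by linarith
  have key : σ * driftEnergy σ v j
      = v j ^ 2 + (2 * σ - 1) * (σ * v (j - 1) - (σ + 1) * v j) ^ 2 := by
    unfold driftEnergy
    ring
  have h3 : 0 ≤ (2 * σ - 1) * (σ * v (j - 1) - (σ + 1) * v j) ^ 2 :=
    mul_nonneg (by linarith) (sq_nonneg _)
  have h4 : σ * v j ^ 2 ≤ 1 * v j ^ 2 := mul_le_mul_of_nonneg_right h2 (sq_nonneg _)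
  exact le_of_mul_le_mul_left (by linarith) hσ

theorem driftEnergy_sub_le {σ τ : ℝ} (h1 : 1 / 2 ≤ σ) (hτ : 0 < τ) (v : ℕ → ℝ) (j : ℕ) :
    driftEnergy σ v (j + 1) - driftEnergy σ v j
      ≤ 4 * τ * (driftD σ τ v j * (σ * v (j + 1) + (1 - σ) * v j)) := by
  have key : 4 * τ * (driftD σ τ v j * (σ * v (j + 1) + (1 - σ) * v j))
      - (driftEnergy σ v (j + 1) - driftEnergy σ v j)
      = σ * (2 * σ - 1) * (v (j + 1) - 2 * v j + v (j - 1)) ^ 2 := by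
    unfold driftEnergy driftD
    rw [Nat.add_sub_cancel]
    field_simp
    ring
  have : 0 ≤ σ * (2 * σ - 1) * (v (j + 1) - 2 * v j + v (j - 1)) ^ 2 :=
    mul_nonneg (mul_nonneg (by linarith) (by linarith)) (sq_nonneg _)
  linarith

theorem fracD_eq (α σ τ : ℝ) {v : ℕ → ℝ} (h0 : v 0 = 0) (j : ℕ) :
    fracD α σ τ v j = τ ^ (-α) / Real.Gamma (2 - α) *
      (∑ s ∈ Finset.range (j + 1), toeplitzC α σ (j - s) * (v (s + 1) - v s)
        - bC α σ (j + 1) * v 1) := by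
  unfold fracD
  congr 1
  rw [Finset.sum_congr rfl fun s _ => by rw [cC_eq_toeplitzC α σ (Nat.sub_le j s), sub_mul],
    Finset.sum_sub_distrib]
  congr 1
  rw [Finset.sum_range_succ', Finset.sum_eq_zero, zero_add]
  · simp [h0]
  · intro s hs
    rw [Finset.mem_range] at hs
    rw [if_neg (by lia), zero_mul]

/-- The squared solution is controlled by the tested scheme, up to a multiple of the first
time level. -/
theorem sq_le_sum_scheme {α σ τ : ℝ} (hα : 0 < α ∧ α < 1) (hσ : σ = 1 - α / 2) (hτ : 0 < τ)
    {v : ℕ → ℝ} (h0 : v 0 = 0) (n : ℕ) :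
    v n ^ 2 ≤ 4 * τ * ∑ j ∈ Finset.range n,
      (driftD σ τ v j + fracD α σ τ v j
        + τ ^ (-α) / Real.Gamma (2 - α) * bC α σ (j + 1) * v 1)
      * (σ * v (j + 1) + (1 - σ) * v j) := by
  have hσ0 : 0 < σ := by linarith
  set A := τ ^ (-α) / Real.Gamma (2 - α)
  have hA : 0 ≤ A :=
    div_nonneg (Real.rpow_nonneg hτ.le _) (Real.Gamma_pos_of_pos (by linarith)).le
  have hconv : 0 ≤ ∑ j ∈ Finset.range n, ∑ s ∈ Finset.range (j + 1),
      toeplitzC α σ (j - s) * (v (s + 1) ^ 2 - v s ^ 2) := by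
    rw [sum_convolution_eq (V := fun s => v s ^ 2) _ (by simp [h0])]
    exact Finset.sum_nonneg fun s _ => mul_nonneg (toeplitzC_nonneg hα hσ0 _) (sq_nonneg _)
  have hstep : ∀ j, driftEnergy σ v (j + 1) - driftEnergy σ v j
      + 2 * τ * A * ∑ s ∈ Finset.range (j + 1),
        toeplitzC α σ (j - s) * (v (s + 1) ^ 2 - v s ^ 2)
      ≤ 4 * τ * ((driftD σ τ v j + fracD α σ τ v j + A * bC α σ (j + 1) * v 1)
        * (σ * v (j + 1) + (1 - σ) * v j)) := by
    intro j
    have h1 := driftEnergy_sub_le (by linarith : 1 / 2 ≤ σ) hτ v j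
    have h2 := mul_le_mul_of_nonneg_left
      (convolution_sq_le (toeplitzC_nonneg hα hσ0) (toeplitzC_succ_succ_le hα hσ0)
        (sq_mul_toeplitzC_one_le hα hσ) v j) (by positivity : 0 ≤ 2 * τ * A)
    rw [fracD_eq α σ τ h0]
    linarith
  have hsum := Finset.sum_le_sum fun j (_ : j ∈ Finset.range n) => hstep j
  rw [Finset.sum_add_distrib, Finset.sum_range_sub, ← Finset.mul_sum, ← Finset.mul_sum] at hsum
  have hE0 : driftEnergy σ v 0 = 0 := by simp [driftEnergy, h0]
  have hEn := sq_le_driftEnergy (by linarith : 1 / 2 ≤ σ) (by linarith) v n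
  have : 0 ≤ 2 * τ * A * ∑ j ∈ Finset.range n, ∑ s ∈ Finset.range (j + 1),
      toeplitzC α σ (j - s) * (v (s + 1) ^ 2 - v s ^ 2) := by positivity
  linarith

/-- Testing the scheme at the first time level. -/
theorem sq_le_scheme_zero {α σ τ : ℝ} (hα : 0 < α ∧ α < 1) (hσ : σ = 1 - α / 2) (hτ : 0 < τ)
    {v : ℕ → ℝ} (h0 : v 0 = 0) :
    v 1 ^ 2 ≤ 2 * τ * ((driftD σ τ v 0 + fracD α σ τ v 0) * v 1) - v 1 ^ 2 := by
  have hσ0 : 0 < σ := by linarith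
  have hA : 0 ≤ τ ^ (-α) / Real.Gamma (2 - α) :=
    div_nonneg (Real.rpow_nonneg hτ.le _) (Real.Gamma_pos_of_pos (by linarith)).le
  have key : 2 * τ * ((driftD σ τ v 0 + fracD α σ τ v 0) * v 1)
      = (2 * σ + 1) * v 1 ^ 2
        + 2 * τ * (τ ^ (-α) / Real.Gamma (2 - α)) * σ ^ (1 - α) * v 1 ^ 2 := by
    simp only [driftD, fracD, cC, aC, h0, Finset.sum_range_one, if_true, zero_add]
    field_simp
    ring_nf
  have h1 : 0 ≤ 2 * τ * (τ ^ (-α) / Real.Gamma (2 - α)) * σ ^ (1 - α) * v 1 ^ 2 := by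
    have := Real.rpow_nonneg hσ0.le (1 - α)
    positivity
  have h2 : 0 ≤ (2 * σ - 1) * v 1 ^ 2 := mul_nonneg (by linarith) (sq_nonneg _)
  linarith

end DiscreteEnergy

section Diffusion

theorem sum_flux_mul (κ w : ℕ → ℝ) (n : ℕ) :
    ∑ i ∈ Finset.range n, (κ (i + 1) * (w (i + 2) - w (i + 1)) - κ i * (w (i + 1) - w i))
        * w (i + 1)
      = κ n * (w (n + 1) - w n) * w (n + 1) - κ 0 * (w 1 - w 0) * w 0
        - ∑ i ∈ Finset.range (n + 1), κ i * (w (i + 1) - w i) ^ 2 := by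
  induction n with
  | zero =>
    simp
    ring
  | succ n ih =>
    rw [Finset.sum_range_succ, ih, Finset.sum_range_succ _ (n + 1)]
    ring

theorem sum_lam1D_mul_nonpos {k q : ℝ → ℝ → ℝ} {h t : ℝ} {w : ℕ → ℝ} {n : ℕ}
    (h0 : w 0 = 0) (hn : w (n + 1) = 0)
    (hk : ∀ i ≤ n, 0 ≤ k ((i : ℝ) * h + h / 2) t)
    (hq : ∀ i ≤ n, 0 ≤ q ((i : ℝ) * h) t) :
    ∑ i ∈ Finset.Icc 1 n, lam1D k q h t w i * w i ≤ 0 := by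
  have hIcc : Finset.Icc 1 n = Finset.Ico 1 (n + 1) := by
    ext i
    simp only [Finset.mem_Icc, Finset.mem_Ico]
    lia
  rw [hIcc, Finset.sum_Ico_eq_sum_range, Nat.add_sub_cancel]
  have hterm : ∀ i, lam1D k q h t w (1 + i) * w (1 + i)
      = 1 / h ^ 2 * ((k (((i + 1 : ℕ) : ℝ) * h + h / 2) t * (w (i + 2) - w (i + 1))
          - k ((i : ℝ) * h + h / 2) t * (w (i + 1) - w i)) * w (i + 1))
        - q (((i + 1 : ℕ) : ℝ) * h) t * w (i + 1) ^ 2 := by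
    intro i
    rw [lam1D, add_comm 1 i, Nat.add_sub_cancel,
      show ((i + 1 : ℕ) : ℝ) * h - h / 2 = (i : ℝ) * h + h / 2 by push_cast; ring]
    ring
  rw [Finset.sum_congr rfl fun i _ => hterm i, Finset.sum_sub_distrib, ← Finset.mul_sum,
    sum_flux_mul (fun i => k ((i : ℝ) * h + h / 2) t), h0, hn]
  have h1 : 0 ≤ ∑ i ∈ Finset.range (n + 1), k ((i : ℝ) * h + h / 2) t * (w (i + 1) - w i) ^ 2 :=
    Finset.sum_nonneg fun i hi =>
      mul_nonneg (hk i (by rw [Finset.mem_range] at hi; lia)) (sq_nonneg _)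
  have h2 : 0 ≤ ∑ i ∈ Finset.range n, q (((i + 1 : ℕ) : ℝ) * h) t * w (i + 1) ^ 2 :=
    Finset.sum_nonneg fun i hi =>
      mul_nonneg (hq _ (by rw [Finset.mem_range] at hi; lia)) (sq_nonneg _)
  have h3 := mul_nonneg (by positivity : 0 ≤ 1 / h ^ 2) h1
  simp only [mul_zero, zero_sub, sub_self, mul_neg]
  linarith

theorem lam1D_combination (k q : ℝ → ℝ → ℝ) (h t σ : ℝ) (u v : ℕ → ℝ) (i : ℕ) :
    σ * lam1D k q h t u i + (1 - σ) * lam1D k q h t v i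
      = lam1D k q h t (fun i => σ * u i + (1 - σ) * v i) i := by
  unfold lam1D
  ring

end Diffusion

theorem nrm2_nonneg {h : ℝ} (hh : 0 ≤ h) (N : ℕ) (v : ℕ → ℝ) : 0 ≤ nrm2 h N v :=
  mul_nonneg hh (Finset.sum_nonneg fun _ _ => sq_nonneg _)

/-- The weights of the first time level in the scheme are of order `1 / τ`. -/
theorem first_level_weight_le {α σ τ T : ℝ} {M j : ℕ} (hα : 0 < α ∧ α < 1)
    (hσ : σ = 1 - α / 2) (hT : 0 < T) (hτ : τ = T / M) (hj : j < M) :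
    (τ ^ (-α) / Real.Gamma (2 - α) * bC α σ (j + 1)) * τ
      ≤ (2 * T) ^ (1 - α) / Real.Gamma (2 - α) := by
  have hM : (0 : ℝ) < M := by exact_mod_cast (by lia : 0 < M)
  have hM1 : (1 : ℝ) ≤ M := by exact_mod_cast (by lia : 1 ≤ M)
  have hτ0 : 0 < τ := by rw [hτ]; positivity
  have hΓ : 0 < Real.Gamma (2 - α) := Real.Gamma_pos_of_pos (by linarith)
  have hjM : (j : ℝ) + 1 ≤ M := by exact_mod_cast hj
  have h1 : bC α σ (j + 1) ≤ (2 * M : ℝ) ^ (1 - α) :=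
    (bC_succ_le hα (by linarith) j).trans
      (Real.rpow_le_rpow (by linarith [(Nat.cast_nonneg j : (0 : ℝ) ≤ j)]) (by linarith)
        (by linarith))
  have h2 : τ ^ (-α) * τ = τ ^ (1 - α) := by
    rw [show 1 - α = -α + 1 by ring, Real.rpow_add_one hτ0.ne']
  calc (τ ^ (-α) / Real.Gamma (2 - α) * bC α σ (j + 1)) * τ
      = τ ^ (1 - α) * bC α σ (j + 1) / Real.Gamma (2 - α) := by
        rw [← h2]
        ring
    _ ≤ τ ^ (1 - α) * (2 * M : ℝ) ^ (1 - α) / Real.Gamma (2 - α) := by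
        gcongr
    _ = (2 * T) ^ (1 - α) / Real.Gamma (2 - α) := by
        rw [← Real.mul_rpow hτ0.le (by positivity), hτ]
        congr 2
        field_simp

/-- Stability of the tested scheme in squared norms, for zero initial data. -/
theorem nrm2_le_of_tested_scheme {α σ τ T h ρ : ℝ} {N M : ℕ} {e R : ℕ → ℕ → ℝ}
    (hα : 0 < α ∧ α < 1) (hσ : σ = 1 - α / 2) (hT : 0 < T) (hM : 1 ≤ M) (hτ : τ = T / M)
    (hh : 0 ≤ h) (he0 : ∀ i ∈ Finset.Icc 1 (N - 1), e 0 i = 0)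
    (hscheme : ∀ j < M,
      ∑ i ∈ Finset.Icc 1 (N - 1),
        (driftD σ τ (fun m => e m i) j + fracD α σ τ (fun m => e m i) j)
          * (σ * e (j + 1) i + (1 - σ) * e j i)
      ≤ ∑ i ∈ Finset.Icc 1 (N - 1), R j i * (σ * e (j + 1) i + (1 - σ) * e j i))
    (hR : ∀ j < M, nrm2 h N (R j) ≤ ρ) (j : ℕ) (hj : j ≤ M) :
    nrm2 h N (e j)
      ≤ 32 * T ^ 2 * (1 + ((2 * T) ^ (1 - α) / Real.Gamma (2 - α)) ^ 2) * ρ := by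
  set B := (2 * T) ^ (1 - α) / Real.Gamma (2 - α)
  set I := Finset.Icc 1 (N - 1)
  have hσ0 : 0 < σ := by linarith
  have hσ1 : σ ≤ 1 := by linarith
  have hM0 : (0 : ℝ) < M := by exact_mod_cast hM
  have hτ0 : 0 < τ := by rw [hτ]; positivity
  have hτM : τ * M = T := by rw [hτ]; field_simp
  have hΓ : 0 < Real.Gamma (2 - α) := Real.Gamma_pos_of_pos (by linarith)
  set β : ℕ → ℝ := fun j => τ ^ (-α) / Real.Gamma (2 - α) * bC α σ (j + 1)
  have hβ0 : ∀ j, 0 ≤ β j := fun j =>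
    mul_nonneg (div_nonneg (Real.rpow_nonneg hτ0.le _) hΓ.le) (bC_succ_nonneg hα hσ0 j)
  have hβ : ∀ j < M, β j * τ ≤ B := fun j hj => first_level_weight_le hα hσ hT hτ hj
  have hfirst : nrm2 h N (e 1) ≤ τ ^ 2 * ρ := by
    have h1 : ∑ i ∈ I, (driftD σ τ (fun m => e m i) 0 + fracD α σ τ (fun m => e m i) 0) * e 1 i
        ≤ ∑ i ∈ I, R 0 i * e 1 i := by
      refine le_of_mul_le_mul_left ?_ hσ0
      have hw : ∀ a : ℕ → ℝ, ∑ i ∈ I, a i * (σ * e (0 + 1) i + (1 - σ) * e 0 i)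
          = σ * ∑ i ∈ I, a i * e 1 i := fun a => by
        rw [Finset.mul_sum]
        refine Finset.sum_congr rfl fun i hi => ?_
        rw [he0 i hi, mul_zero, add_zero, zero_add, mul_left_comm]
      rw [← hw, ← hw]
      exact hscheme 0 (by lia)
    have h2 : ∑ i ∈ I, e 1 i ^ 2 ≤ ∑ i ∈ I, (2 * τ *
        ((driftD σ τ (fun m => e m i) 0 + fracD α σ τ (fun m => e m i) 0) * e 1 i)
          - e 1 i ^ 2) :=
      Finset.sum_le_sum fun i hi =>
        sq_le_scheme_zero (v := fun m => e m i) hα hσ hτ0 (he0 i hi)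
    have h3 : ∑ i ∈ I, 2 * τ * (R 0 i * e 1 i) ≤ ∑ i ∈ I, (τ ^ 2 * R 0 i ^ 2 + e 1 i ^ 2) :=
      Finset.sum_le_sum fun i _ => by nlinarith [sq_nonneg (τ * R 0 i - e 1 i)]
    rw [Finset.sum_sub_distrib, ← Finset.mul_sum] at h2
    rw [Finset.sum_add_distrib, ← Finset.mul_sum, ← Finset.mul_sum] at h3
    have h4 := mul_le_mul_of_nonneg_left h1 (by positivity : 0 ≤ 2 * τ)
    have h5 : ∑ i ∈ I, e 1 i ^ 2 ≤ τ ^ 2 * ∑ i ∈ I, R 0 i ^ 2 := by linarith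
    calc nrm2 h N (e 1) ≤ h * (τ ^ 2 * ∑ i ∈ I, R 0 i ^ 2) := mul_le_mul_of_nonneg_left h5 hh
      _ = τ ^ 2 * nrm2 h N (R 0) := by
        unfold nrm2
        ring
      _ ≤ τ ^ 2 * ρ := mul_le_mul_of_nonneg_left (hR 0 (by lia)) (sq_nonneg τ)
  obtain ⟨m, hm, hmax⟩ := Finset.exists_max_image (Finset.range (M + 1))
    (fun j => nrm2 h N (e j)) ⟨0, by simp⟩
  have hmM : m ≤ M := by rw [Finset.mem_range] at hm; lia
  set D := nrm2 h N (e m)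
  have hD : ∀ j ≤ M, nrm2 h N (e j) ≤ D := fun j hj => hmax j (by rw [Finset.mem_range]; lia)
  set P := 2 * (1 + B ^ 2) * ρ with hP
  have hlevel : ∀ j < M, h * ∑ i ∈ I,
      (driftD σ τ (fun m => e m i) j + fracD α σ τ (fun m => e m i) j + β j * e 1 i)
        * (σ * e (j + 1) i + (1 - σ) * e j i) ≤ 2 * T * P + D / (8 * T) := by
    intro j hj
    have h1 : ∑ i ∈ I,
        (driftD σ τ (fun m => e m i) j + fracD α σ τ (fun m => e m i) j + β j * e 1 i)
          * (σ * e (j + 1) i + (1 - σ) * e j i)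
        ≤ ∑ i ∈ I, (R j i + β j * e 1 i) * (σ * e (j + 1) i + (1 - σ) * e j i) := by
      have h := add_le_add_left (hscheme j hj)
        (∑ i ∈ I, β j * e 1 i * (σ * e (j + 1) i + (1 - σ) * e j i))
      simpa only [← Finset.sum_add_distrib, ← add_mul] using h
    have h2 : ∀ i, (R j i + β j * e 1 i) * (σ * e (j + 1) i + (1 - σ) * e j i)
        ≤ 4 * T * R j i ^ 2 + 4 * T * β j ^ 2 * e 1 i ^ 2
          + (σ / (8 * T) * e (j + 1) i ^ 2 + (1 - σ) / (8 * T) * e j i ^ 2) := by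
      intro i
      set x := R j i
      set y := β j * e 1 i with hy
      set a := e (j + 1) i
      set b := e j i
      have key : 4 * T * x ^ 2 + 4 * T * β j ^ 2 * e 1 i ^ 2
          + (σ / (8 * T) * a ^ 2 + (1 - σ) / (8 * T) * b ^ 2)
          - (x + y) * (σ * a + (1 - σ) * b)
          = 2 * T * (x - y) ^ 2
            + (4 * T * (x + y) - (σ * a + (1 - σ) * b)) ^ 2 / (8 * T)
            + σ * (1 - σ) * (a - b) ^ 2 / (8 * T) := by
        rw [show 4 * T * β j ^ 2 * e 1 i ^ 2 = 4 * T * y ^ 2 by rw [hy]; ring]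
        field_simp
        ring
      have hσ' : 0 ≤ 1 - σ := by linarith
      have : 0 ≤ 2 * T * (x - y) ^ 2
            + (4 * T * (x + y) - (σ * a + (1 - σ) * b)) ^ 2 / (8 * T)
            + σ * (1 - σ) * (a - b) ^ 2 / (8 * T) := by positivity
      linarith
    have h3 := mul_le_mul_of_nonneg_left (h1.trans (Finset.sum_le_sum fun i _ => h2 i)) hh
    have h4 : h * ∑ i ∈ I, (4 * T * R j i ^ 2 + 4 * T * β j ^ 2 * e 1 i ^ 2
          + (σ / (8 * T) * e (j + 1) i ^ 2 + (1 - σ) / (8 * T) * e j i ^ 2))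
        = 4 * T * nrm2 h N (R j) + 4 * T * β j ^ 2 * nrm2 h N (e 1)
          + (σ / (8 * T) * nrm2 h N (e (j + 1)) + (1 - σ) / (8 * T) * nrm2 h N (e j)) := by
      unfold nrm2
      simp only [Finset.sum_add_distrib, ← Finset.mul_sum]
      ring
    have h5 : β j ^ 2 * nrm2 h N (e 1) ≤ B ^ 2 * ρ := by
      have hρ : 0 ≤ ρ := (nrm2_nonneg hh N _).trans (hR j hj)
      calc β j ^ 2 * nrm2 h N (e 1) ≤ β j ^ 2 * (τ ^ 2 * ρ) :=
            mul_le_mul_of_nonneg_left hfirst (sq_nonneg _)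
        _ = (β j * τ) ^ 2 * ρ := by ring
        _ ≤ B ^ 2 * ρ := by
          have := hβ j hj
          have := hβ0 j
          gcongr
    have h6 : σ / (8 * T) * nrm2 h N (e (j + 1)) ≤ σ / (8 * T) * D :=
      mul_le_mul_of_nonneg_left (hD _ hj) (by positivity)
    have h7 : (1 - σ) / (8 * T) * nrm2 h N (e j) ≤ (1 - σ) / (8 * T) * D :=
      mul_le_mul_of_nonneg_left (hD _ hj.le) (div_nonneg (by linarith) (by positivity))
    have h8 : 4 * T * nrm2 h N (R j) ≤ 4 * T * ρ :=
      mul_le_mul_of_nonneg_left (hR j hj) (by positivity)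
    have h9 := mul_le_mul_of_nonneg_left h5 (by positivity : 0 ≤ 4 * T)
    calc _ ≤ _ := h3
      _ = _ := h4
      _ ≤ 4 * T * ρ + 4 * T * (B ^ 2 * ρ) + (σ / (8 * T) * D + (1 - σ) / (8 * T) * D) := by
        linarith
      _ = 2 * T * P + D / (8 * T) := by
        rw [hP]
        ring
  have hDle : D ≤ 8 * T ^ 2 * P + D / 2 := by
    have hρ : 0 ≤ ρ := (nrm2_nonneg hh N _).trans (hR 0 (by lia))
    have hD0 : 0 ≤ D := nrm2_nonneg hh N _
    have h1 : ∑ i ∈ I, e m i ^ 2 ≤ ∑ i ∈ I, 4 * τ * ∑ j ∈ Finset.range m,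
        (driftD σ τ (fun m => e m i) j + fracD α σ τ (fun m => e m i) j + β j * e 1 i)
          * (σ * e (j + 1) i + (1 - σ) * e j i) :=
      Finset.sum_le_sum fun i hi =>
        sq_le_sum_scheme (v := fun m => e m i) hα hσ hτ0 (he0 i hi) m
    rw [← Finset.mul_sum, Finset.sum_comm] at h1
    calc D ≤ h * (4 * τ * ∑ j ∈ Finset.range m, ∑ i ∈ I,
          (driftD σ τ (fun m => e m i) j + fracD α σ τ (fun m => e m i) j + β j * e 1 i)
            * (σ * e (j + 1) i + (1 - σ) * e j i)) := mul_le_mul_of_nonneg_left h1 hh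
      _ = 4 * τ * ∑ j ∈ Finset.range m, h * ∑ i ∈ I,
          (driftD σ τ (fun m => e m i) j + fracD α σ τ (fun m => e m i) j + β j * e 1 i)
            * (σ * e (j + 1) i + (1 - σ) * e j i) := by
        rw [← Finset.mul_sum]
        ring
      _ ≤ 4 * τ * ∑ j ∈ Finset.range m, (2 * T * P + D / (8 * T)) := by
        refine mul_le_mul_of_nonneg_left (Finset.sum_le_sum fun j hj => hlevel j ?_)
          (by positivity)
        rw [Finset.mem_range] at hj
        lia
      _ = 4 * τ * (m * (2 * T * P + D / (8 * T))) := by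
        rw [Finset.sum_const, Finset.card_range, nsmul_eq_mul]
      _ ≤ 4 * τ * (M * (2 * T * P + D / (8 * T))) := by gcongr
      _ = 4 * (τ * M) * (2 * T * P + D / (8 * T)) := by ring
      _ = 8 * T ^ 2 * P + D / 2 := by
        rw [hτM]
        field_simp
        ring
  have := hD j hj
  rw [hP] at hDle
  linarith

/-- Convergence of the implicit L2-1_σ scheme for the 1D time fractional
reaction-diffusion equation: if the error grid function satisfies the error
equation with residuals of size `K(τ² + h²)`, then the error is `O(τ² + h²)`
in the discrete `L₂` norm, with a constant independent of the grids. -/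
theorem convergence_1D (α : ℝ) (hα : 0 < α ∧ α < 1) (σ : ℝ)
    (hσ : σ = 1 - α / 2) (T : ℝ) (hT : 0 < T) (K : ℝ) (hK : 0 < K) :
    ∃ C₂ > 0, ∀ (L : ℝ) (N M : ℕ) (h τ : ℝ) (k q : ℝ → ℝ → ℝ) (C₀ : ℝ)
      (e R : ℕ → ℕ → ℝ),
      0 < L → 2 ≤ N → 1 ≤ M → h = L / N → τ = T / M → 0 < C₀ →
      (∀ x ∈ Set.Icc 0 L, ∀ t ∈ Set.Icc 0 T, C₀ ≤ k x t) →
      (∀ x ∈ Set.Icc 0 L, ∀ t ∈ Set.Icc 0 T, 0 ≤ q x t) →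
      (∀ i, i ≤ N → e 0 i = 0) →
      (∀ j, j ≤ M → e j 0 = 0 ∧ e j N = 0) →
      (∀ j < M, ∀ i, 1 ≤ i → i ≤ N - 1 →
        driftD σ τ (fun m => e m i) j + fracD α σ τ (fun m => e m i) j
          = σ * lam1D k q h (((j : ℝ) + σ) * τ) (e (j + 1)) i
            + (1 - σ) * lam1D k q h (((j : ℝ) + σ) * τ) (e j) i
            + R j i) →
      (∀ j < M, Real.sqrt (nrm2 h N (R j)) ≤ K * (τ ^ 2 + h ^ 2)) →
      ∀ j, j ≤ M → Real.sqrt (nrm2 h N (e j)) ≤ C₂ * (τ ^ 2 + h ^ 2) := by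
  have hσ0 : 0 < σ := by linarith
  have hσ1 : σ ≤ 1 := by linarith
  set B := (2 * T) ^ (1 - α) / Real.Gamma (2 - α) with hB
  have hB0 : 0 ≤ B := div_nonneg (Real.rpow_nonneg (by positivity) _)
    (Real.Gamma_pos_of_pos (by linarith)).le
  refine ⟨8 * T * K * (1 + B), by positivity, ?_⟩
  intro L N M h τ k q C₀ e R hL hN hM hh hτ hC₀ hk hq he0 hbd heq hR j hj
  have hN0 : (0 : ℝ) < N := by exact_mod_cast (by lia : 0 < N)
  have hM0 : (0 : ℝ) < M := by exact_mod_cast hM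
  have hh0 : 0 < h := by rw [hh]; positivity
  have hτ0 : 0 < τ := by rw [hτ]; positivity
  have hNh : N * h = L := by rw [hh]; field_simp
  have hMτ : M * τ = T := by rw [hτ]; field_simp
  have hscheme : ∀ j < M,
      ∑ i ∈ Finset.Icc 1 (N - 1),
        (driftD σ τ (fun m => e m i) j + fracD α σ τ (fun m => e m i) j)
          * (σ * e (j + 1) i + (1 - σ) * e j i)
      ≤ ∑ i ∈ Finset.Icc 1 (N - 1), R j i * (σ * e (j + 1) i + (1 - σ) * e j i) := by
    intro j hj
    have hjM : (j : ℝ) + 1 ≤ M := by exact_mod_cast hj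
    have ht : ((j : ℝ) + σ) * τ ∈ Set.Icc 0 T := by
      refine ⟨by positivity, ?_⟩
      rw [← hMτ]
      exact mul_le_mul_of_nonneg_right (by linarith) hτ0.le
    have hx : ∀ i ≤ N - 1, ((i : ℝ) + 1) * h ≤ L := fun i hi => by
      have : (i : ℝ) + 1 ≤ N := by exact_mod_cast (by lia : i + 1 ≤ N)
      rw [← hNh]
      exact mul_le_mul_of_nonneg_right this hh0.le
    have hlam := sum_lam1D_mul_nonpos (k := k) (q := q) (h := h) (t := ((j : ℝ) + σ) * τ)
      (w := fun i => σ * e (j + 1) i + (1 - σ) * e j i) (n := N - 1)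
      (by simp [(hbd (j + 1) hj).1, (hbd j hj.le).1])
      (by
        rw [Nat.sub_add_cancel (by lia)]
        simp [(hbd (j + 1) hj).2, (hbd j hj.le).2])
      (fun i hi => hC₀.le.trans (hk _ ⟨by positivity, by linarith [hx i hi]⟩ _ ht))
      (fun i hi => hq _ ⟨by positivity, by linarith [hx i hi]⟩ _ ht)
    rw [Finset.sum_congr rfl fun i hi => by
      rw [heq j hj i (Finset.mem_Icc.1 hi).1 (Finset.mem_Icc.1 hi).2, lam1D_combination,
        add_mul], Finset.sum_add_distrib]
    linarith
  have hρ : 0 ≤ K * (τ ^ 2 + h ^ 2) := by positivity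
  have hR' : ∀ j < M, nrm2 h N (R j) ≤ (K * (τ ^ 2 + h ^ 2)) ^ 2 := fun j hj =>
    (Real.sqrt_le_left hρ).1 (hR j hj)
  refine (Real.sqrt_le_left (by positivity)).2 ?_
  refine (nrm2_le_of_tested_scheme hα hσ hT hM hτ hh0.le
    (fun i hi => he0 i (by rw [Finset.mem_Icc] at hi; lia)) hscheme hR' j hj).trans ?_
  rw [← hB, show (8 * T * K * (1 + B) * (τ ^ 2 + h ^ 2)) ^ 2
    = (64 * T ^ 2 * (1 + B) ^ 2) * (K * (τ ^ 2 + h ^ 2)) ^ 2 by ring]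
  refine mul_le_mul_of_nonneg_right ?_ (sq_nonneg _)
  have : 0 ≤ T ^ 2 * (32 * (1 + B ^ 2) + 128 * B) := by positivity
  linarith
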